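/- A trace-closed ω-language L ⊆ Σ^ω is recognized by an I-diamond deterministic weak automaton if and only if there exist finitely many regular trace-closed languages K_1, …, K_n ⊆ Σ* such that L is a finite Boolean combination (built with finite unions, finite intersections, and complements) of the ω-languages ext((K_1)_I), …, ext((K_n)_I). -/

import Mathlib

open Relation

variable {A : Type*} {σ : Type*} {S : Type*}

/-- The length-`n` prefix of an ω-word. -/
def wpre (α : ℕ → A) (n : ℕ) : List A := (List.range n).map α

/-- One swap of two adjacent independent letters. -/
def SwapStep (I : A → A → Prop) (u v : List A) : Prop :=
  ∃ (x y : List A) (a b : A), I a b ∧ u = x ++ a :: b :: y ∧ v = x ++ b :: a :: y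

/-- Trace equivalence `∼_I` on finite words: the equivalence closure of adjacent swaps. -/
def TrEq (I : A → A → Prop) : List A → List A → Prop := EqvGen (SwapStep I)

/-- Trace-prefix relation `u ⊑_I v`. -/
def TrPre (I : A → A → Prop) (u v : List A) : Prop := ∃ w, TrEq I (u ++ w) v

/-- Trace equivalence `≈_I` of ω-words. -/
def OmEq (I : A → A → Prop) (α β : ℕ → A) : Prop :=
  (∀ n, ∃ m, TrPre I (wpre α n) (wpre β m)) ∧ (∀ n, ∃ m, TrPre I (wpre β n) (wpre α m))

/-- A language of finite words is trace-closed. -/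
def TraceClosed (I : A → A → Prop) (K : Set (List A)) : Prop :=
  ∀ u v, u ∈ K → TrEq I u v → v ∈ K

/-- An ω-language is trace-closed. -/
def OmTraceClosed (I : A → A → Prop) (L : Set (ℕ → A)) : Prop :=
  ∀ α β, α ∈ L → OmEq I α β → β ∈ L

/-- `ext(K)`: ω-words with some finite prefix in `K`. -/
def extL (K : Set (List A)) : Set (ℕ → A) := {α | ∃ n, wpre α n ∈ K}

/-- `lim(K)`: ω-words with infinitely many finite prefixes in `K`. -/
def limL (K : Set (List A)) : Set (ℕ → A) := {α | ∀ N, ∃ n ≥ N, wpre α n ∈ K}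

/-- `[L]_{≈_I}`: the ω-trace closure of an ω-language. -/
def omCl (I : A → A → Prop) (L : Set (ℕ → A)) : Set (ℕ → A) := {α | ∃ β ∈ L, OmEq I α β}

/-- The `I`-suffix extension `K_I`. -/
def suffExt (I : A → A → Prop) (K : Set (List A)) : Set (List A) :=
  K ∪ {w | ∃ (a : A) (u x : List A),
    u ++ [a] ∈ K ∧ (∀ b ∈ x, I a b) ∧ TrEq I w (u ++ [a] ++ x)}

/-- A language is regular iff it is recognized by a DFA with finitely many states. -/
def RegularLang (K : Set (List A)) : Prop :=
  ∃ (σ : Type) (_ : Fintype σ) (M : DFA A σ), ∀ w, w ∈ M.accepts ↔ w ∈ K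

/-- A DFA is `I`-diamond. -/
def IDiamond (I : A → A → Prop) (M : DFA A σ) : Prop :=
  ∀ q a b, I a b → M.step (M.step q a) b = M.step (M.step q b) a

/-- The ω-language of a DFA viewed as a deterministic Büchi automaton. -/
def BuchiLang (M : DFA A σ) : Set (ℕ → A) :=
  {α | ∀ N, ∃ n ≥ N, M.evalFrom M.start (wpre α n) ∈ M.accept}

/-- The weakness condition: mutually reachable states agree on acceptance. -/
def IsWeak (M : DFA A σ) : Prop :=
  ∀ q q', (∃ u, M.evalFrom q u = q') → (∃ v, M.evalFrom q' v = q) →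
    (q ∈ M.accept ↔ q' ∈ M.accept)

/-- States visited infinitely often by the run of a DFA on an ω-word. -/
def InfStates (M : DFA A σ) (α : ℕ → A) : Set σ :=
  {q | ∀ N, ∃ n ≥ N, M.evalFrom M.start (wpre α n) = q}

/-- The ω-language of a DFA equipped with a Muller acceptance family. -/
def MullerLang (M : DFA A σ) (F : Set (Set σ)) : Set (ℕ → A) := {α | InfStates M α ∈ F}

/-- An ω-language is ω-regular iff it is recognized by a deterministic Muller automaton. -/
def OmegaRegular (L : Set (ℕ → A)) : Prop :=
  ∃ (σ : Type) (_ : Fintype σ) (M : DFA A σ) (F : Set (Set σ)), MullerLang M F = L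

/-- Finite Boolean combinations of a family of sets. -/
inductive BoolComb {X : Type*} (G : Set (Set X)) : Set X → Prop
  | base {L} : L ∈ G → BoolComb G L
  | compl {L} : BoolComb G L → BoolComb G Lᶜ
  | union {L₁ L₂} : BoolComb G L₁ → BoolComb G L₂ → BoolComb G (L₁ ∪ L₂)
  | inter {L₁ L₂} : BoolComb G L₁ → BoolComb G L₂ → BoolComb G (L₁ ∩ L₂)

/-- `φ : Σ* → S` is a monoid homomorphism (words under concatenation). -/
def IsHom [Monoid S] (φ : List A → S) : Prop :=
  φ [] = 1 ∧ ∀ u v, φ (u ++ v) = φ u * φ v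

/-- Linked pair of a monoid. -/
def LinkedPair [Monoid S] (s e : S) : Prop := s * e = s ∧ e * e = e

/-- The factor `α[i, j)` of an ω-word. -/
def seg (α : ℕ → A) (i j : ℕ) : List A := (List.range (j - i)).map (fun k => α (i + k))

/-- `φ⁻¹(s)·(φ⁻¹(e))^ω`: ω-words admitting a factorization `u·v₁·v₂⋯` with
`φ(u) = s` and `φ(vᵢ) = e`. -/
def LPWords (φ : List A → S) (s e : S) : Set (ℕ → A) :=
  {α | ∃ n : ℕ → ℕ, StrictMono n ∧ φ (wpre α (n 0)) = s ∧
    ∀ i, φ (seg α (n i) (n (i + 1))) = e}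

/-- `φ` saturates an ω-language `L`. -/
def Saturates [Monoid S] (φ : List A → S) (L : Set (ℕ → A)) : Prop :=
  ∀ s e : S, LinkedPair s e → LPWords φ s e ∩ L = ∅ ∨ LPWords φ s e ⊆ L

/-- The `P`-cut property of a linked pair `(s, e)` with respect to `φ`. -/
def PCut [Monoid S] (φ : List A → S) (P : Set S) (s e : S) : Prop :=
  (∀ w : List A, w ≠ [] → φ w = e →
      ∃ j, 1 ≤ j ∧ j ≤ w.length ∧ s * e * φ (w.take j) ∈ P) ∨
  (∀ w : List A, w ≠ [] → φ w = e →
      ∀ j, 1 ≤ j → j ≤ w.length → s * e * φ (w.take j) ∉ P)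

/-- The run from `q` on `u` visits an accepting state (endpoints included). -/
def VisitsAcc (M : DFA A σ) (q : σ) (u : List A) : Prop :=
  ∃ p, p <+: u ∧ M.evalFrom q p ∈ M.accept

/-- `q ⇒_u q'`: the run from `q` on `u` ends in `q'` and visits an accepting state. -/
def FICycleClosed (I : A → A → Prop) (M : DFA A σ) : Prop :=
  ∀ u v q, TrEq I u v →
    ((M.evalFrom q u = q ∧ VisitsAcc M q u) ↔ (M.evalFrom q v = q ∧ VisitsAcc M q v))

section helpers

variable {I : A → A → Prop}

theorem TrEq.rfl' (u : List A) : TrEq I u u := EqvGen.refl u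
theorem TrEq.symm' {u v : List A} (h : TrEq I u v) : TrEq I v u := EqvGen.symm _ _ h
theorem TrEq.trans' {u v w : List A} (h : TrEq I u v) (h' : TrEq I v w) : TrEq I u w :=
  EqvGen.trans _ _ _ h h'

theorem TrEq.ctx {u v : List A} (x y : List A) (h : TrEq I u v) :
    TrEq I (x ++ u ++ y) (x ++ v ++ y) := by
  induction h with
  | rel u v h =>
    obtain ⟨p, q, a, b, hab, rfl, rfl⟩ := h
    exact EqvGen.rel _ _ ⟨x ++ p, q ++ y, a, b, hab, by simp, by simp⟩
  | refl u => exact EqvGen.refl _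
  | symm u v _ ih => exact EqvGen.symm _ _ ih
  | trans u v w _ _ ih1 ih2 => exact EqvGen.trans _ _ _ ih1 ih2

theorem TrEq.right {u v : List A} (y : List A) (h : TrEq I u v) : TrEq I (u ++ y) (v ++ y) := by
  simpa using h.ctx [] y

theorem TrEq.left {u v : List A} (x : List A) (h : TrEq I u v) : TrEq I (x ++ u) (x ++ v) := by
  simpa using h.ctx x []

/-- a letter commutes through a block of independent letters -/
theorem TrEq.comm (a : A) (x : List A) (hx : ∀ b ∈ x, I a b) : TrEq I (a :: x) (x ++ [a]) := by
  induction x with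
  | nil => exact TrEq.rfl' _
  | cons c x ih =>
    have h1 : TrEq I (a :: c :: x) (c :: a :: x) :=
      EqvGen.rel _ _ ⟨[], x, a, c, hx c (by simp), rfl, rfl⟩
    have h2 := (ih (fun b hb => hx b (by simp [hb]))).left [c]
    exact h1.trans' (by simpa using h2)

theorem TrEq.comm_mid (u : List A) (a : A) (x : List A) (hx : ∀ b ∈ x, I a b) :
    TrEq I (u ++ [a] ++ x) (u ++ x ++ [a]) := by
  simpa using (TrEq.comm a x hx).left u

def LastB (I : A → A → Prop) (p : List A) (b : A) (z : List A) : Prop :=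
  ∃ z1 z2, z = z1 ++ b :: z2 ∧ (∀ c ∈ z2, I b c) ∧ TrEq I p (z1 ++ z2)

theorem LastB.swap (hirr : ∀ a, ¬ I a a) (hsym : ∀ a b, I a b → I b a)
    {p : List A} {b : A} {z z' : List A} (h : LastB I p b z) (hs : SwapStep I z z') :
    LastB I p b z' := by
  obtain ⟨z1, z2, rfl, h2, h3⟩ := h
  obtain ⟨x, y, c, d, hcd, he, rfl⟩ := hs
  rw [List.append_eq_append_iff] at he
  rcases he with ⟨l, rfl, hl⟩ | ⟨l, rfl, hl⟩
  · -- x = z1 ++ l, b :: z2 = l ++ c :: d :: y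
    cases l with
    | nil =>
      simp at hl
      obtain ⟨rfl, rfl⟩ := hl
      refine ⟨z1 ++ [d], y, by simp, fun c hc => h2 c (by simp [hc]), ?_⟩
      simpa using h3
    | cons e l =>
      simp at hl
      obtain ⟨rfl, rfl⟩ := hl
      refine ⟨z1, l ++ d :: c :: y, by simp, ?_, ?_⟩
      · intro e he
        apply h2
        simp at he ⊢
        tauto
      · refine h3.trans' ?_
        exact EqvGen.rel _ _ ⟨z1 ++ l, y, c, d, hcd, by simp, by simp⟩
  · -- z1 = x ++ l,  c :: d :: y = l ++ b :: z2
    match l, hl with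
    | [], hl =>
      simp at hl
      obtain ⟨rfl, rfl⟩ := hl
      refine ⟨x ++ [d], y, by simp, fun c hc => h2 c (by simp [hc]), ?_⟩
      simpa using h3
    | [e], hl =>
      simp at hl
      obtain ⟨rfl, rfl, rfl⟩ := hl
      refine ⟨x, c :: y, by simp, ?_, ?_⟩
      · intro e he
        rcases List.mem_cons.1 he with rfl | he
        · exact hsym _ _ hcd
        · exact h2 _ he
      · simpa using h3
    | e :: f :: l, hl =>
      simp at hl
      obtain ⟨rfl, rfl, rfl⟩ := hl
      refine ⟨x ++ d :: c :: l, z2, by simp, h2, ?_⟩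
      refine h3.trans' ?_
      exact EqvGen.rel _ _ ⟨x, l ++ z2, c, d, hcd, by simp, by simp⟩

theorem LastB.iff (hirr : ∀ a, ¬ I a a) (hsym : ∀ a b, I a b → I b a)
    {p : List A} {b : A} {z z' : List A} (h : TrEq I z z') :
    LastB I p b z ↔ LastB I p b z' := by
  induction h with
  | rel u v h =>
    refine ⟨fun k => k.swap hirr hsym h, fun k => k.swap hirr hsym ?_⟩
    obtain ⟨x, y, c, d, hcd, rfl, rfl⟩ := h
    exact ⟨x, y, d, c, hsym _ _ hcd, rfl, rfl⟩
  | refl u => rfl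
  | symm u v _ ih => exact ih.symm
  | trans u v w _ _ ih1 ih2 => exact ih1.trans ih2

theorem lastB_of (hirr : ∀ a, ¬ I a a) (hsym : ∀ a b, I a b → I b a)
    {p : List A} {b : A} {z : List A} (h : TrEq I (p ++ [b]) z) : LastB I p b z := by
  rw [← LastB.iff hirr hsym h]
  exact ⟨p, [], by simp, by simp, by simpa using TrEq.rfl' p⟩

theorem split_last (hirr : ∀ a, ¬ I a a) (hsym : ∀ a b, I a b → I b a)
    {p : List A} {b : A} {u x : List A} (h : TrEq I (p ++ [b]) (u ++ x)) :
    (∃ x1 x2, x = x1 ++ b :: x2 ∧ TrEq I p (u ++ (x1 ++ x2))) ∨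
    (∃ u', TrEq I u (u' ++ [b]) ∧ TrEq I p (u' ++ x) ∧ ∀ c ∈ x, I b c) := by
  obtain ⟨z1, z2, he, h2, h3⟩ := lastB_of hirr hsym h
  rw [List.append_eq_append_iff] at he
  rcases he with ⟨l, rfl, hl⟩ | ⟨l, rfl, hl⟩
  · exact Or.inl ⟨l, z2, hl, by simpa using h3⟩
  · cases l with
    | nil =>
      simp at hl
      subst hl
      exact Or.inl ⟨[], z2, by simp, by simpa using h3⟩
    | cons e l =>
      simp at hl
      obtain ⟨rfl, rfl⟩ := hl
      refine Or.inr ⟨z1 ++ l, ?_, by simpa using h3, fun c hc => h2 c (by simp [hc])⟩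
      simpa using TrEq.comm_mid z1 b l (fun c hc => h2 c (by simp [hc]))

/-- `p·a` is in the suffix extension with `a` as pivot. -/
def J0 (I : A → A → Prop) (K : Set (List A)) (p : List A) (a : A) : Prop :=
  ∃ u x, TrEq I p (u ++ x) ∧ (∀ c ∈ x, I a c) ∧ u ++ [a] ∈ K

def JJ (I : A → A → Prop) (K : Set (List A)) : Language A :=
  {w | [] ∈ K ∨ ∃ p a, p ++ [a] <+: w ∧ J0 I K p a}

theorem JJ_snoc (K : Set (List A)) (w : List A) (a : A) :
    w ++ [a] ∈ JJ I K ↔ w ∈ JJ I K ∨ J0 I K w a := by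
  constructor
  · rintro (h | ⟨p, b, hp, h⟩)
    · exact Or.inl (Or.inl h)
    · rw [List.prefix_concat_iff] at hp
      rcases hp with hp | hp
      · have := List.append_inj' hp rfl
        obtain ⟨rfl, h2⟩ := this
        simp at h2
        subst h2
        exact Or.inr h
      · exact Or.inl (Or.inr ⟨p, b, hp, h⟩)
  · rintro ((h | ⟨p, b, hp, h⟩) | h)
    · exact Or.inl h
    · exact Or.inr ⟨p, b, hp.trans (List.prefix_append _ _), h⟩
    · exact Or.inr ⟨w, a, List.prefix_refl _, h⟩

theorem JJ_append {K : Set (List A)} {w : List A} (v : List A) (h : w ∈ JJ I K) :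
    w ++ v ∈ JJ I K := by
  rcases h with h | ⟨p, b, hp, h⟩
  · exact Or.inl h
  · exact Or.inr ⟨p, b, hp.trans (List.prefix_append _ _), h⟩

theorem J0_congr {K : Set (List A)} {w w' : List A} {a : A} (h : TrEq I w w') (hj : J0 I K w a) :
    J0 I K w' a := by
  obtain ⟨u, x, h1, h2, h3⟩ := hj
  exact ⟨u, x, h.symm'.trans' h1, h2, h3⟩

theorem JJ_swap (hirr : ∀ a, ¬ I a a) (hsym : ∀ a b, I a b → I b a) {K : Set (List A)}
    (hK : TraceClosed I K) (w : List A) (b c : A) (hbc : I b c) (h : w ++ [b] ++ [c] ∈ JJ I K) :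
    w ++ [c] ++ [b] ∈ JJ I K := by
  rw [JJ_snoc, JJ_snoc] at h
  rcases h with (h | h) | h
  · exact JJ_append _ (JJ_append _ h)
  · obtain ⟨u, x, h1, h2, h3⟩ := h
    rw [JJ_snoc]
    refine Or.inr ⟨u, x ++ [c], by simpa using h1.right [c], ?_, h3⟩
    intro d hd
    simp at hd
    rcases hd with hd | rfl
    · exact h2 _ hd
    · exact hbc
  · obtain ⟨u, x, h1, h2, h3⟩ := h
    rcases split_last hirr hsym h1 with ⟨x1, x2, rfl, h4⟩ | ⟨u', h4, h5, h6⟩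
    · apply JJ_append
      rw [JJ_snoc]
      refine Or.inr ⟨u, x1 ++ x2, h4, fun d hd => h2 d ?_, h3⟩
      simp at hd ⊢
      tauto
    · rw [JJ_snoc]
      refine Or.inr ⟨u' ++ [c], x, ?_, h6, ?_⟩
      · exact (h5.right [c]).trans' (TrEq.comm_mid u' c x h2).symm'
      · have h7 : u' ++ [b] ++ [c] ∈ K := hK _ _ h3 (h4.right [c])
        refine hK _ _ h7 ?_
        exact TrEq.comm_mid u' b [c] (by simpa using hbc)

theorem JJ_closed (hirr : ∀ a, ¬ I a a) (hsym : ∀ a b, I a b → I b a) {K : Set (List A)}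
    (hK : TraceClosed I K) {u v : List A} (h : TrEq I u v) : u ∈ JJ I K ↔ v ∈ JJ I K := by
  induction h with
  | rel u v h =>
    obtain ⟨x, y, c, d, hcd, rfl, rfl⟩ := h
    induction y using List.reverseRecOn with
    | nil =>
      have h1 := JJ_swap hirr hsym hK x c d hcd
      have h2 := JJ_swap hirr hsym hK x d c (hsym _ _ hcd)
      simp only [List.append_assoc, List.singleton_append] at h1 h2
      exact ⟨h1, h2⟩
    | append_singleton y e ih =>
      have h1 := JJ_snoc (I := I) K (x ++ c :: d :: y) e
      have h2 := JJ_snoc (I := I) K (x ++ d :: c :: y) e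
      simp only [List.append_assoc, List.cons_append] at h1 h2
      rw [h1, h2, ih]
      have h3 : TrEq I (x ++ c :: d :: y) (x ++ d :: c :: y) :=
        EqvGen.rel _ _ ⟨x, y, c, d, hcd, rfl, rfl⟩
      exact or_congr Iff.rfl ⟨J0_congr h3, J0_congr h3.symm'⟩
  | refl u => rfl
  | symm u v _ ih => exact ih.symm
  | trans u v w _ _ ih1 ih2 => exact ih1.trans ih2

theorem suffExt_sub_JJ (hirr : ∀ a, ¬ I a a) (hsym : ∀ a b, I a b → I b a) {K : Set (List A)}
    (hK : TraceClosed I K) {w : List A} (h : w ∈ suffExt I K) : w ∈ JJ I K := by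
  have key : ∀ w ∈ K, w ∈ JJ I K := by
    intro w hw
    induction w using List.reverseRecOn with
    | nil => exact Or.inl hw
    | append_singleton w a _ =>
      rw [JJ_snoc]
      exact Or.inr ⟨w, [], by simpa using TrEq.rfl' w, by simp, hw⟩
  rcases h with h | ⟨a, u, x, h1, h2, h3⟩
  · exact key _ h
  · rw [JJ_closed hirr hsym hK h3]
    exact JJ_append _ (key _ h1)

theorem JJ_prefix {K : Set (List A)} {w : List A} (h : w ∈ JJ I K) :
    ∃ p, p <+: w ∧ p ∈ suffExt I K := by
  rcases h with h | ⟨p, a, hp, u, x, h1, h2, h3⟩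
  · exact ⟨[], by simp, Or.inl h⟩
  · exact ⟨_, hp, Or.inr ⟨a, u, x, h3, h2, (h1.right [a]).trans' (TrEq.comm_mid u a x h2).symm'⟩⟩

theorem wpre_succ (α : ℕ → A) (n : ℕ) : wpre α (n + 1) = wpre α n ++ [α n] := by
  simp [wpre, List.range_succ]

theorem wpre_add (α : ℕ → A) (n k : ℕ) : ∃ v, wpre α (n + k) = wpre α n ++ v := by
  induction k with
  | zero => exact ⟨[], by simp⟩
  | succ k ih =>
    obtain ⟨v, hv⟩ := ih
    exact ⟨v ++ [α (n + k)], by rw [← add_assoc, wpre_succ, hv]; simp⟩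

theorem prefix_wpre {α : ℕ → A} {n : ℕ} {p : List A} (h : p <+: wpre α n) :
    ∃ m, p = wpre α m := by
  induction n with
  | zero => exact ⟨0, by simpa [wpre] using h⟩
  | succ n ih =>
    rw [wpre_succ, List.prefix_concat_iff] at h
    rcases h with h | h
    · exact ⟨n + 1, by rw [h, wpre_succ]⟩
    · exact ih h

theorem extL_suffExt (hirr : ∀ a, ¬ I a a) (hsym : ∀ a b, I a b → I b a) {K : Set (List A)}
    (hK : TraceClosed I K) (α : ℕ → A) :
    α ∈ extL (suffExt I K) ↔ ∃ n, wpre α n ∈ JJ I K := by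
  constructor
  · rintro ⟨n, hn⟩
    exact ⟨n, suffExt_sub_JJ hirr hsym hK hn⟩
  · rintro ⟨n, hn⟩
    obtain ⟨p, hp, hp'⟩ := JJ_prefix hn
    obtain ⟨m, rfl⟩ := prefix_wpre hp
    exact ⟨m, hp'⟩

/-- finite invariant -/
def kq (K : Set (List A)) (u : List A) : Set (List A) := {y | u ++ y ∈ K}

theorem kq_congr {K : Set (List A)} (hK : TraceClosed I K) {u v : List A} (h : TrEq I u v) :
    kq K u = kq K v := by
  ext y
  exact ⟨fun k => hK _ _ k (h.right y), fun k => hK _ _ k (h.symm'.right y)⟩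

theorem kq_snoc {K : Set (List A)} {u v : List A} (h : kq K u = kq K v) (b : A) :
    kq K (u ++ [b]) = kq K (v ++ [b]) := by
  ext y
  have := Set.ext_iff.1 h (b :: y)
  simpa [kq] using this

def Phi (I : A → A → Prop) (K : Set (List A)) (p : List A) : Set (Set (List A) × Set A) :=
  {s | ∃ u x, TrEq I p (u ++ x) ∧ kq K u = s.1 ∧ {c | c ∈ x} = s.2}

theorem Phi_snoc (hirr : ∀ a, ¬ I a a) (hsym : ∀ a b, I a b → I b a) {K : Set (List A)}
    (hK : TraceClosed I K) {w w' : List A} (b : A) (h : Phi I K w ⊆ Phi I K w') :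
    Phi I K (w ++ [b]) ⊆ Phi I K (w' ++ [b]) := by
  rintro ⟨k, X⟩ ⟨u, x, h1, h2, h3⟩
  simp only at h2 h3
  rcases split_last hirr hsym h1 with ⟨x1, x2, rfl, h4⟩ | ⟨u', h4, h5, h6⟩
  · obtain ⟨v, y, g1, g2, g3⟩ := h (show (kq K u, {c | c ∈ x1 ++ x2}) ∈ Phi I K w from
      ⟨u, _, h4, rfl, rfl⟩)
    simp only at g2 g3
    refine ⟨v, y ++ [b], by simpa using g1.right [b], g2.trans h2, ?_⟩
    simp only
    rw [← h3]
    ext c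
    have := Set.ext_iff.1 g3 c
    simp at this ⊢
    tauto
  · obtain ⟨v, y, g1, g2, g3⟩ := h (show (kq K u', {c | c ∈ x}) ∈ Phi I K w from
      ⟨u', _, h5, rfl, rfl⟩)
    simp only at g2 g3
    refine ⟨v ++ [b], y, ?_, ?_, g3.trans h3⟩
    · refine (g1.right [b]).trans' (TrEq.comm_mid v b y ?_).symm'
      intro c hc
      exact h6 c ((Set.ext_iff.1 g3 c).1 hc)
    · simp only
      rw [← h2, kq_congr hK h4]
      exact kq_snoc g2 b

theorem Phi_J0 {K : Set (List A)} {w w' : List A} (b : A) (h : Phi I K w ⊆ Phi I K w')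
    (hj : J0 I K w b) : J0 I K w' b := by
  obtain ⟨u, x, h1, h2, h3⟩ := hj
  obtain ⟨v, y, g1, g2, g3⟩ := h (show (kq K u, {c | c ∈ x}) ∈ Phi I K w from
      ⟨u, _, h1, rfl, rfl⟩)
  simp only at g2 g3
  refine ⟨v, y, g1, fun c hc => h2 c ((Set.ext_iff.1 g3 c).1 hc), ?_⟩
  exact (Set.ext_iff.1 g2 [b]).2 h3

theorem Phi_JJ (hirr : ∀ a, ¬ I a a) (hsym : ∀ a b, I a b → I b a) {K : Set (List A)}
    (hK : TraceClosed I K) {w w' : List A} (h : Phi I K w ⊆ Phi I K w')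
    (hj : w ∈ JJ I K → w' ∈ JJ I K) (y : List A) :
    w ++ y ∈ JJ I K → w' ++ y ∈ JJ I K := by
  induction y generalizing w w' with
  | nil => simpa using hj
  | cons b y ih =>
    have := ih (w := w ++ [b]) (w' := w' ++ [b]) (Phi_snoc hirr hsym hK b h) (by
      rw [JJ_snoc, JJ_snoc]
      exact Or.imp hj (Phi_J0 b h))
    simpa using this

theorem finite_range_factor {X Y Z : Type*} {f : X → Y} {g : X → Z}
    (hfg : ∀ x x', g x = g x' → f x = f x') (hg : (Set.range g).Finite) :
    (Set.range f).Finite := by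
  classical
  rcases isEmpty_or_nonempty X with hX | hX
  · rw [Set.range_eq_empty]; exact Set.finite_empty
  · refine (hg.image (fun z => f (Function.invFun g z))).subset ?_
    rintro _ ⟨x, rfl⟩
    refine ⟨g x, ⟨x, rfl⟩, hfg _ _ (Function.invFun_eq ⟨x, rfl⟩)⟩

theorem JJ_finite [Fintype A] (hirr : ∀ a, ¬ I a a) (hsym : ∀ a b, I a b → I b a)
    {K : Set (List A)} (hK : TraceClosed I K) (hreg : RegularLang K) :
    (Set.range (JJ I K).leftQuotient).Finite := by
  obtain ⟨σ, _, M, hM⟩ := hreg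
  have hk : (Set.range (kq K)).Finite := by
    refine finite_range_factor (g := M.eval) ?_ (Set.toFinite _)
    intro u v h
    ext y
    simp only [kq, Set.mem_ofPred_eq, ← hM]
    rw [DFA.mem_accepts, DFA.mem_accepts]
    change M.evalFrom M.start (u ++ y) ∈ _ ↔ M.evalFrom M.start (v ++ y) ∈ _
    rw [DFA.evalFrom_of_append, DFA.evalFrom_of_append]
    change M.evalFrom (M.eval u) y ∈ _ ↔ M.evalFrom (M.eval v) y ∈ _
    rw [h]
  refine finite_range_factor (g := fun w => (Phi I K w, w ∈ JJ I K)) ?_ ?_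
  · intro w w' h
    simp only [Prod.mk.injEq] at h
    ext y
    rw [Language.mem_leftQuotient, Language.mem_leftQuotient]
    exact ⟨Phi_JJ hirr hsym hK h.1.subset (by rw [h.2]; exact id) y,
      Phi_JJ hirr hsym hK h.1.symm.subset (by rw [h.2]; exact id) y⟩
  · refine (((hk.prod (Set.toFinite (Set.univ : Set (Set A)))).powerset).prod
      (Set.toFinite (Set.univ : Set Prop))).subset ?_
    rintro _ ⟨w, rfl⟩
    refine ⟨?_, trivial⟩
    rintro ⟨k, X⟩ ⟨u, x, _, h2, _⟩
    exact ⟨⟨u, h2⟩, trivial⟩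

/-- Boolean combinations. -/
theorem BoolComb.determined {X ι : Type*} {G : ι → Set X} {L : Set X}
    (h : BoolComb (Set.range G) L) :
    ∃ P : Set (Set ι), ∀ x, x ∈ L ↔ {i | x ∈ G i} ∈ P := by
  induction h with
  | base h =>
    obtain ⟨i, rfl⟩ := h
    exact ⟨{T | i ∈ T}, fun x => Iff.rfl⟩
  | compl _ ih =>
    obtain ⟨P, hP⟩ := ih
    exact ⟨Pᶜ, fun x => not_congr (hP x)⟩
  | union _ _ ih1 ih2 =>
    obtain ⟨P, hP⟩ := ih1
    obtain ⟨Q, hQ⟩ := ih2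
    exact ⟨P ∪ Q, fun x => or_congr (hP x) (hQ x)⟩
  | inter _ _ ih1 ih2 =>
    obtain ⟨P, hP⟩ := ih1
    obtain ⟨Q, hQ⟩ := ih2
    exact ⟨P ∩ Q, fun x => and_congr (hP x) (hQ x)⟩

theorem BoolComb.of_determined {X ι : Type*} [Fintype ι] [Nonempty ι] {G : ι → Set X} {L : Set X}
    (h : ∀ x y, (∀ i, x ∈ G i ↔ y ∈ G i) → x ∈ L → y ∈ L) : BoolComb (Set.range G) L := by
  classical
  obtain ⟨i0⟩ := ‹Nonempty ι›
  have h0 : BoolComb (Set.range G) (G i0) := .base ⟨i0, rfl⟩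
  have hE : BoolComb (Set.range G) ∅ := by
    have := h0.inter h0.compl
    simpa using this
  have hU : BoolComb (Set.range G) Set.univ := by
    have := h0.union h0.compl
    simpa using this
  have hun : ∀ (s : Finset (Set ι)) (f : Set ι → Set X), (∀ T, BoolComb (Set.range G) (f T)) →
      BoolComb (Set.range G) (⋃ T ∈ s, f T) := by
    intro s f hf
    induction s using Finset.induction_on with
    | empty => simpa using hE
    | insert a s _ ih =>
      rw [Finset.set_biUnion_insert]
      exact (hf a).union ih
  have hin : ∀ (s : Finset ι) (f : ι → Set X), (∀ T, BoolComb (Set.range G) (f T)) →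
      BoolComb (Set.range G) (⋂ T ∈ s, f T) := by
    intro s f hf
    induction s using Finset.induction_on with
    | empty => simpa using hU
    | insert a s _ ih =>
      rw [Finset.set_biInter_insert]
      exact (hf a).inter ih
  have hLeq : L = ⋃ T ∈ (Finset.univ.filter fun T : Set ι => ∃ x ∈ L, {i | x ∈ G i} = T),
      ⋂ i ∈ (Finset.univ : Finset ι), if i ∈ T then G i else (G i)ᶜ := by
    ext y
    simp only [Set.mem_iUnion, Set.mem_iInter, Finset.mem_filter, Finset.mem_univ, true_and,
      forall_true_left, exists_prop]
    constructor
    · intro hy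
      refine ⟨_, ⟨y, hy, rfl⟩, fun i => ?_⟩
      by_cases hi : y ∈ G i <;> simp [hi]
    · rintro ⟨T, ⟨x, hx, rfl⟩, hT⟩
      refine h x y (fun i => ?_) hx
      have := hT i
      by_cases hi : x ∈ G i
      · simpa [hi] using this
      · simpa [hi] using this
  rw [hLeq]
  apply hun
  intro T
  apply hin
  intro i
  by_cases hi : i ∈ T
  · simpa [hi] using BoolComb.base (G := Set.range G) ⟨i, rfl⟩
  · simpa [hi] using (BoolComb.base (G := Set.range G) ⟨i, rfl⟩).compl

theorem evalFrom_congr {τ : Type*} {M : DFA A τ} (hM : IDiamond I M) {u v : List A}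
    (h : TrEq I u v) (q : τ) : M.evalFrom q u = M.evalFrom q v := by
  induction h with
  | rel u v h =>
    obtain ⟨x, y, a, b, hab, rfl, rfl⟩ := h
    simp only [DFA.evalFrom_of_append, DFA.evalFrom_cons, hM _ a b hab]
  | refl u => rfl
  | symm u v _ ih => exact ih.symm
  | trans u v w _ _ ih1 ih2 => exact ih1.trans ih2

/-- the forward direction -/
theorem forward (L : Set (ℕ → A)) (τ : Type) [Fintype τ] (M : DFA A τ)
    (hd : IDiamond I M) (hw : IsWeak M) (hML : BuchiLang M = L) :
    ∃ (n : ℕ) (Ks : Fin n → Set (List A)),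
        (∀ i, RegularLang (Ks i) ∧ TraceClosed I (Ks i)) ∧
        BoolComb (Set.range fun i => extL (suffExt I (Ks i))) L := by
  classical
  let R : τ → Set (List A) := fun q => {w | ∃ v, M.evalFrom q v = M.evalFrom M.start w}
  have hR_app : ∀ q w v, w ∈ R q → w ++ v ∈ R q := by
    rintro q w v ⟨x, hx⟩
    exact ⟨x ++ v, by rw [DFA.evalFrom_of_append, DFA.evalFrom_of_append, hx]⟩
  have hR_tc : ∀ q, TraceClosed I (R q) := by
    rintro q u v ⟨x, hx⟩ h
    exact ⟨x, hx.trans (evalFrom_congr hd h _)⟩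
  have hR_reg : ∀ q, RegularLang (R q) := by
    intro q
    exact ⟨τ, inferInstance, ⟨M.step, M.start, {s | ∃ v, M.evalFrom q v = s}⟩, fun w => Iff.rfl⟩
  have hR_suff : ∀ q, suffExt I (R q) = R q := by
    intro q
    ext w
    constructor
    · rintro (h | ⟨a, u, x, h1, _, h3⟩)
      · exact h
      · exact hR_tc q _ _ (hR_app q _ x h1) h3.symm'
    · exact Or.inl
  let e := Fintype.equivFin τ
  refine ⟨Fintype.card τ, fun i => R (e.symm i), fun i => ⟨hR_reg _, hR_tc _⟩, ?_⟩
  haveI : Nonempty (Fin (Fintype.card τ)) := ⟨e M.start⟩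
  apply BoolComb.of_determined
  intro α β hab hα
  have hab' : ∀ q, (∃ n, wpre α n ∈ R q) ↔ (∃ n, wpre β n ∈ R q) := by
    intro q
    have := hab (e q)
    simp only [hR_suff, Equiv.symm_apply_apply] at this
    exact this
  have hinf : ∀ (α : ℕ → A) (P : Set τ), (∀ N, ∃ n ≥ N, M.evalFrom M.start (wpre α n) ∈ P) →
      ∃ p ∈ P, ∀ N, ∃ n ≥ N, M.evalFrom M.start (wpre α n) = p := by
    intro α P hP
    by_contra! hcon
    have : ∀ p, ∃ N, p ∈ P → ∀ n ≥ N, M.evalFrom M.start (wpre α n) ≠ p := by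
      intro p
      by_cases hp : p ∈ P
      · obtain ⟨N, hN⟩ := hcon p hp
        exact ⟨N, fun _ => hN⟩
      · exact ⟨0, fun h => absurd h hp⟩
    choose N hN using this
    obtain ⟨n, hn, hnP⟩ := hP (Finset.univ.sup N)
    exact hN _ hnP n ((Finset.le_sup (f := N) (Finset.mem_univ _)).trans hn) rfl
  have hreach : ∀ (α : ℕ → A) (q p : τ), (∃ n, wpre α n ∈ R q) →
      (∀ N, ∃ n ≥ N, M.evalFrom M.start (wpre α n) = p) → ∃ v, M.evalFrom q v = p := by
    rintro α q p ⟨n, hn⟩ hp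
    obtain ⟨m, hm, rfl⟩ := hp n
    obtain ⟨k, rfl⟩ := Nat.exists_eq_add_of_le hm
    obtain ⟨v, hv⟩ := wpre_add α n k
    rw [hv]
    exact hR_app _ _ _ hn
  have hself : ∀ (α : ℕ → A) (p : τ),
      (∀ N, ∃ n ≥ N, M.evalFrom M.start (wpre α n) = p) → ∃ n, wpre α n ∈ R p := by
    intro α p hp
    obtain ⟨n, _, hn⟩ := hp 0
    exact ⟨n, [], by simp [hn]⟩
  rw [← hML] at hα ⊢
  obtain ⟨p, hpa, hp⟩ := hinf α M.accept hα
  obtain ⟨p', -, hp'⟩ := hinf β Set.univ (fun N => ⟨N, le_rfl, trivial⟩)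
  have h1 := hreach β p p' ((hab' p).1 (hself α p hp)) hp'
  have h2 := hreach α p' p ((hab' p').2 (hself β p' hp')) hp
  have hacc : p' ∈ M.accept := (hw p p' h1 h2).1 hpa
  intro N
  obtain ⟨n, hn, hn'⟩ := hp' N
  exact ⟨n, hn, hn' ▸ hacc⟩

theorem to_type0 {τ : Type*} [Fintype τ] (M : DFA A τ) (hd : IDiamond I M) (hw : IsWeak M) :
    ∃ (σ : Type) (_ : Fintype σ) (M' : DFA A σ),
        IDiamond I M' ∧ IsWeak M' ∧ BuchiLang M' = BuchiLang M := by
  classical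
  let e := Fintype.equivFin τ
  refine ⟨Fin (Fintype.card τ), inferInstance, DFA.reindex e M, ?_, ?_, ?_⟩
  · intro q a b hab
    simp [DFA.reindex, hd _ a b hab]
  · rintro q q' ⟨u, hu⟩ ⟨v, hv⟩
    rw [DFA.evalFrom_reindex] at hu hv
    refine hw (e.symm q) (e.symm q') ⟨u, by rw [← hu]; simp⟩ ⟨v, by rw [← hv]; simp⟩
  · ext α
    simp only [BuchiLang, DFA.evalFrom_reindex, Set.mem_ofPred_eq]
    simp [DFA.reindex]

theorem toDFA_diamond (hirr : ∀ a, ¬ I a a) (hsym : ∀ a b, I a b → I b a) {K : Set (List A)}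
    (hK : TraceClosed I K) : IDiamond I (JJ I K).toDFA := by
  rintro ⟨_, w, rfl⟩ a b hab
  apply Subtype.ext
  simp only [Language.step_toDFA]
  ext y
  simp only [Language.mem_leftQuotient]
  apply JJ_closed hirr hsym hK
  exact EqvGen.rel _ _ ⟨w, y, a, b, hab, by simp, by simp⟩

theorem toDFA_mono {K : Set (List A)} (q : Set.range (JJ I K).leftQuotient) (v : List A)
    (h : q ∈ (JJ I K).toDFA.accept) : (JJ I K).toDFA.evalFrom q v ∈ (JJ I K).toDFA.accept := by
  induction v using List.reverseRecOn with
  | nil => exact h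
  | append_singleton v a ih =>
    rw [DFA.evalFrom_append_singleton]
    generalize (JJ I K).toDFA.evalFrom q v = r at ih
    obtain ⟨_, w, rfl⟩ := r
    rw [Language.mem_accept_toDFA] at ih ⊢
    simp only [Language.step_toDFA, Language.mem_leftQuotient] at ih ⊢
    exact JJ_append (w := w) [a] (by simpa using ih)

def prodDFA {ι : Type*} {τ : ι → Type*} (M : ∀ i, DFA A (τ i)) (P : Set (Set ι)) :
    DFA A (∀ i, τ i) where
  step q a i := (M i).step (q i) a
  start i := (M i).start
  accept := {q | {i | q i ∈ (M i).accept} ∈ P}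

theorem prodDFA_eval {ι : Type*} {τ : ι → Type*} (M : ∀ i, DFA A (τ i)) (P : Set (Set ι))
    (q : ∀ i, τ i) (w : List A) (i : ι) :
    (prodDFA M P).evalFrom q w i = (M i).evalFrom (q i) w := by
  induction w generalizing q with
  | nil => rfl
  | cons a w ih =>
    rw [DFA.evalFrom_cons, DFA.evalFrom_cons, ih]
    rfl

theorem backward [Fintype A] (hirr : ∀ a, ¬ I a a) (hsym : ∀ a b, I a b → I b a)
    (L : Set (ℕ → A)) (n : ℕ) (Ks : Fin n → Set (List A))
    (hKs : ∀ i, RegularLang (Ks i) ∧ TraceClosed I (Ks i))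
    (hB : BoolComb (Set.range fun i => extL (suffExt I (Ks i))) L) :
    ∃ (σ : Type) (_ : Fintype σ) (M : DFA A σ),
        IDiamond I M ∧ IsWeak M ∧ BuchiLang M = L := by
  classical
  obtain ⟨P, hP⟩ := hB.determined
  let M := fun i => (JJ I (Ks i)).toDFA
  haveI : ∀ i, Fintype (Set.range (JJ I (Ks i)).leftQuotient) := fun i =>
    (JJ_finite hirr hsym (hKs i).2 (hKs i).1).fintype
  have hdi : IDiamond I (prodDFA M P) := by
    intro q a b hab
    funext i
    exact toDFA_diamond hirr hsym (hKs i).2 (q i) a b hab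
  have hwk : IsWeak (prodDFA M P) := by
    rintro q q' ⟨u, hu⟩ ⟨v, hv⟩
    have : {i | q i ∈ (M i).accept} = {i | q' i ∈ (M i).accept} := by
      ext i
      constructor
      · intro h
        have := toDFA_mono _ u h
        rw [← hu, Set.mem_ofPred_eq, prodDFA_eval]
        exact this
      · intro h
        have := toDFA_mono _ v h
        rw [← hv, Set.mem_ofPred_eq, prodDFA_eval]
        exact this
    change _ ∈ P ↔ _ ∈ P
    rw [this]
  have hlang : BuchiLang (prodDFA M P) = L := by
    ext α
    have hacc : ∀ i w, (M i).evalFrom (M i).start w ∈ (M i).accept ↔ w ∈ JJ I (Ks i) := by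
      intro i w
      have := Set.ext_iff.1 (Language.accepts_toDFA (JJ I (Ks i))) w
      exact this
    have hext := fun i => extL_suffExt hirr hsym (hKs i).2 α
    have hN : ∀ i, ∃ N, ∀ m ≥ N, (wpre α m ∈ JJ I (Ks i) ↔ α ∈ extL (suffExt I (Ks i))) := by
      intro i
      by_cases h : ∃ n, wpre α n ∈ JJ I (Ks i)
      · obtain ⟨N, hN⟩ := h
        refine ⟨N, fun m hm => iff_of_true ?_ ((hext i).2 ⟨N, hN⟩)⟩
        obtain ⟨k, rfl⟩ := Nat.exists_eq_add_of_le hm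
        obtain ⟨v, hv⟩ := wpre_add α N k
        rw [hv]
        exact JJ_append _ hN
      · exact ⟨0, fun m _ => iff_of_false (fun k => h ⟨m, k⟩) (fun k => h ((hext i).1 k))⟩
    choose N hN using hN
    have hev : ∀ m ≥ Finset.univ.sup N,
        ((prodDFA M P).evalFrom (prodDFA M P).start (wpre α m) ∈ (prodDFA M P).accept ↔
          α ∈ L) := by
      intro m hm
      rw [hP]
      have : {i | (prodDFA M P).evalFrom (prodDFA M P).start (wpre α m) i ∈ (M i).accept} =
          {i | α ∈ extL (suffExt I (Ks i))} := by
        ext i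
        rw [Set.mem_ofPred_eq, prodDFA_eval, Set.mem_ofPred_eq,
          ← hN i m ((Finset.le_sup (f := N) (Finset.mem_univ i)).trans hm)]
        exact hacc i _
      rw [← this]
      rfl
    constructor
    · intro h
      obtain ⟨m, hm, h'⟩ := h (Finset.univ.sup N)
      exact (hev m hm).1 h'
    · intro h K
      exact ⟨max K (Finset.univ.sup N), le_max_left _ _, (hev _ (le_max_right _ _)).2 h⟩
  obtain ⟨σ, hσ, M', h1, h2, h3⟩ := to_type0 (prodDFA M P) hdi hwk
  exact ⟨σ, hσ, M', h1, h2, h3.trans hlang⟩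

end helpers

/-- A trace-closed ω-language is recognized by an `I`-diamond DWA
iff it is a finite Boolean combination of languages `ext((K_i)_I)` for regular
trace-closed `K_i`. -/
theorem stmt4 [Fintype A] (I : A → A → Prop)
    (hirr : ∀ a, ¬ I a a) (hsym : ∀ a b, I a b → I b a)
    (L : Set (ℕ → A)) (hL : OmTraceClosed I L) :
    (∃ (σ : Type) (_ : Fintype σ) (M : DFA A σ),
        IDiamond I M ∧ IsWeak M ∧ BuchiLang M = L) ↔
    (∃ (n : ℕ) (Ks : Fin n → Set (List A)),
        (∀ i, RegularLang (Ks i) ∧ TraceClosed I (Ks i)) ∧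
        BoolComb (Set.range fun i => extL (suffExt I (Ks i))) L) := by
  constructor
  · rintro ⟨τ, hτ, M, hd, hw, hML⟩
    exact forward L τ M hd hw hML
  · rintro ⟨n, Ks, hKs, hB⟩
    exact backward hirr hsym L n Ks hKs hB
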